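/- arXiv:2604.13792 — 2 statements merged into one kernel-verified Lean document; each statement's English description precedes it below -/
import Mathlib

section
/- Let 𝓜_Σ ⊆ ℝ^{n×(n+m)} be a set of matrices, let 𝓤_k ⊆ ℝ^m for each k ≥ 0 be input sets, let 𝓩_w ⊆ ℝ^n be a noise set, and let 𝓡₀ ⊆ ℝ^n be an initial set. Define the reachable sets recursively by 𝓡_{k+1} = {Σ·[x; u] + w : Σ ∈ 𝓜_Σ, x ∈ 𝓡_k, u ∈ 𝓤_k, w ∈ 𝓩_w}, where [x; u] ∈ ℝ^{n+m} stacks x and u. Let P ∈ ℝ^{n×n} be orthogonal, set Q = blkdiag(P, I_m), and define the transformed data 𝓜̃_Σ = {Pᵀ Σ Q : Σ ∈ 𝓜_Σ}, 𝓩̃_w = {Pᵀ w : w ∈ 𝓩_w}, 𝓡̃₀ = {Pᵀ x : x ∈ 𝓡₀}, and the transformed recursion 𝓡̃_{k+1} = {Σ̃·[z; u] + w̃ : Σ̃ ∈ 𝓜̃_Σ, z ∈ 𝓡̃_k, u ∈ 𝓤_k, w̃ ∈ 𝓩̃_w}. Then 𝓡̃_k = {Pᵀ x : x ∈ 𝓡_k}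 for all k ≥ 0. -/
open Matrix

/-- Changing coordinates by `P` on the state turns `Σ [x; u] + w` into its image under `Pᵀ`. -/
theorem transpose_mul_mul_fromBlocks_mulVec_add {ι κ α : Type*} [Fintype ι] [Fintype κ]
    [DecidableEq ι] [DecidableEq κ] [CommRing α] {P : Matrix ι ι α} (hP : P * Pᵀ = 1)
    (S : Matrix ι (ι ⊕ κ) α) (x w : ι → α) (u : κ → α) :
    (Pᵀ * S * fromBlocks P 0 0 (1 : Matrix κ κ α)) *ᵥ Sum.elim (Pᵀ *ᵥ x) u + Pᵀ *ᵥ w =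
      Pᵀ *ᵥ (S *ᵥ Sum.elim x u + w) := by
  have h : fromBlocks P 0 0 (1 : Matrix κ κ α) *ᵥ Sum.elim (Pᵀ *ᵥ x) u = Sum.elim x u := by
    simp [fromBlocks_mulVec, mulVec_mulVec, hP]
  rw [← mulVec_mulVec, h, ← mulVec_mulVec, mulVec_add]

/-- Data-driven reachability is equivariant under orthogonal
coordinate changes: the transformed reachable sets satisfy `𝓡̃_k = Pᵀ · 𝓡_k`. -/
theorem reachable_sets_orthogonal_invariance {n m : ℕ}
    (Msig : Set (Matrix (Fin n) (Fin n ⊕ Fin m) ℝ))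
    (U : ℕ → Set (Fin m → ℝ))
    (Zw : Set (Fin n → ℝ))
    (R0 : Set (Fin n → ℝ))
    (P : Matrix (Fin n) (Fin n) ℝ)
    (hP1 : Pᵀ * P = 1) (hP2 : P * Pᵀ = 1)
    (Q : Matrix (Fin n ⊕ Fin m) (Fin n ⊕ Fin m) ℝ)
    (hQ : Q = Matrix.fromBlocks P 0 0 (1 : Matrix (Fin m) (Fin m) ℝ))
    (MsigT : Set (Matrix (Fin n) (Fin n ⊕ Fin m) ℝ))
    (hMsigT : MsigT = (fun Sig => Pᵀ * Sig * Q) '' Msig)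
    (ZwT : Set (Fin n → ℝ)) (hZwT : ZwT = (fun w => Pᵀ.mulVec w) '' Zw)
    (R Rt : ℕ → Set (Fin n → ℝ))
    (hR0 : R 0 = R0)
    (hR : ∀ k, R (k + 1) =
      {y | ∃ Sig ∈ Msig, ∃ x ∈ R k, ∃ u ∈ U k, ∃ w ∈ Zw,
        y = Sig.mulVec (Sum.elim x u) + w})
    (hRt0 : Rt 0 = (fun x => Pᵀ.mulVec x) '' R0)
    (hRt : ∀ k, Rt (k + 1) =
      {y | ∃ SigT ∈ MsigT, ∃ z ∈ Rt k, ∃ u ∈ U k, ∃ wt ∈ ZwT,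
        y = SigT.mulVec (Sum.elim z u) + wt}) :
    ∀ k, Rt k = (fun x => Pᵀ.mulVec x) '' R k := by
  intro k
  induction k with
  | zero => rw [hRt0, hR0]
  | succ k ih =>
    rw [hRt, hR, ih, hMsigT, hZwT, hQ]
    ext y
    constructor
    · rintro ⟨_, ⟨S, hS, rfl⟩, _, ⟨x, hx, rfl⟩, u, hu, _, ⟨w, hw, rfl⟩, rfl⟩
      exact ⟨_, ⟨S, hS, x, hx, u, hu, w, hw, rfl⟩,
        (transpose_mul_mul_fromBlocks_mulVec_add hP2 S x w u).symm⟩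
    · rintro ⟨_, ⟨S, hS, x, hx, u, hu, w, hw, rfl⟩, rfl⟩
      exact ⟨_, ⟨S, hS, rfl⟩, _, ⟨x, hx, rfl⟩, u, hu, _, ⟨w, hw, rfl⟩,
        (transpose_mul_mul_fromBlocks_mulVec_add hP2 S x w u).symm⟩
end

section
/- Consider the data equation X₊ = Σ M + W₋ with Σ ∈ ℝ^{n×(n+m)}, M = [X₋; U₋] ∈ ℝ^{(n+m)×T}, X₊, W₋ ∈ ℝ^{n×T}. Assume: (1) for each j ∈ {1,…,T}, the j-th column of W₋ satisfies w_j = Σ_{i=1}^{p} ξ_{i,j} g_w^{(i)} with ξ_{i,j} ∈ [-1,1] and fixed g_w^{(1)},…,g_w^{(p)} ∈ ℝ^n; (2) H ∈ ℝ^{T×(n+m)} is a right inverse of M, i.e. M H = I_{n+m}. Then Σ belongs to the matrix zonotope with center C = X₊ H and rank-one generators G^{(i,j)} = −g_w^{(i)} h_jᵀ (h_jᵀ the j-th row of H); that is, there exist β_{i,j} ∈ [-1,1] such that Σ = C + Σ_{i=1}^{p} Σ_{j=1}^{T} β_{i,j} G^{(i,j)}. -/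
open Matrix

/-- Noise-to-matrix-zonotope factorization: any `Σ` consistent
with the data equation `X₊ = Σ [X₋; U₋] + W₋` with column-wise bounded noise lies
in the matrix zonotope with center `C = X₊ H` and rank-one generators
`G^{(i,j)} = −g_w^{(i)} h_jᵀ`. -/
theorem sigma_in_matrix_zonotope {n m T p : ℕ}
    (Sig : Matrix (Fin n) (Fin n ⊕ Fin m) ℝ)
    (Xm : Matrix (Fin n) (Fin T) ℝ) (Um : Matrix (Fin m) (Fin T) ℝ)
    (Xp Wm : Matrix (Fin n) (Fin T) ℝ)
    (hdata : Xp = Sig * Matrix.fromRows Xm Um + Wm)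
    (g : Fin p → (Fin n → ℝ))
    (ξ : Fin p → Fin T → ℝ)
    (hξ : ∀ i j, |ξ i j| ≤ 1)
    (hW : ∀ k j, Wm k j = ∑ i, ξ i j * g i k)
    (H : Matrix (Fin T) (Fin n ⊕ Fin m) ℝ)
    (hH : Matrix.fromRows Xm Um * H = 1) :
    ∃ β : Fin p → Fin T → ℝ, (∀ i j, |β i j| ≤ 1) ∧
      Sig = Xp * H + ∑ i, ∑ j, β i j • (-(Matrix.vecMulVec (g i) (H j))) := by
  refine ⟨ξ, hξ, ?_⟩
  have hWH : Wm * H = ∑ i, ∑ j, ξ i j • Matrix.vecMulVec (g i) (H j) := by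
    ext k l
    simp only [Matrix.mul_apply, Matrix.sum_apply, Matrix.smul_apply, Matrix.vecMulVec_apply,
      smul_eq_mul, hW, Finset.sum_mul]
    rw [Finset.sum_comm]
    simp only [mul_assoc]
  simp only [smul_neg, Finset.sum_neg_distrib]
  rw [← hWH, hdata, Matrix.add_mul, Matrix.mul_assoc, hH, Matrix.mul_one, add_neg_cancel_right]
end
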